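/- For Lebesgue-almost every x ∈ [0,1], the digits of the P₃-representation of x have asymptotic frequencies given by the weights: for each s ∈ {0,1,2}, lim_{k→∞} N_s(x,k)/k = p_s, where N_s(x,k) denotes the number of occurrences of the digit s among the first k digits of the P₃-representation of x. -/

import Mathlib

open Filter MeasureTheory Finset

/-- The "beta" values `β₀ = 0`, `β₁ = p₀`, `β₂ = p₀ + p₁` associated with weights `p`. -/
noncomputable def P3beta (p : Fin 3 → ℝ) : Fin 3 → ℝ := ![0, p 0, p 0 + p 1]

/-- The P₃-value of a digit sequence `i : ℕ → Fin 3` (0-indexed):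
`val(i) = β_{i₀} + Σ_{k≥1} β_{i_k} ∏_{r<k} p_{i_r}`. -/
noncomputable def P3val (p : Fin 3 → ℝ) (i : ℕ → Fin 3) : ℝ :=
  ∑' k : ℕ, P3beta p (i k) * ∏ r ∈ Finset.range k, p (i r)

/-- The digit permutation θ with θ(0)=0, θ(1)=2, θ(2)=1. -/
def P3theta : Fin 3 → Fin 3 := ![0, 2, 1]

/-- The one-sided shift on digit sequences. -/
def P3shift (i : ℕ → Fin 3) : ℕ → Fin 3 := fun k => i (k + 1)

/-- The first digit of the P₃-representation of a point of `[0, 1)`. -/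
noncomputable def P3digit (p : Fin 3 → ℝ) (x : ℝ) : Fin 3 :=
  if x < p 0 then 0 else if x < p 0 + p 1 then 1 else 2

/-- The piecewise affine expanding map of `[0, 1)` that shifts P₃-representations. -/
noncomputable def P3map (p : Fin 3 → ℝ) (x : ℝ) : ℝ :=
  (x - P3beta p (P3digit p x)) / p (P3digit p x)

lemma measurable_P3digit (p : Fin 3 → ℝ) : Measurable (P3digit p) :=
  Measurable.ite measurableSet_Iio measurable_const
    (Measurable.ite measurableSet_Iio measurable_const measurable_const)

lemma measurable_P3map (p : Fin 3 → ℝ) : Measurable (P3map p) :=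
  (measurable_id.sub ((measurable_of_finite (P3beta p)).comp (measurable_P3digit p))).div
    ((measurable_of_finite p).comp (measurable_P3digit p))

lemma P3beta_nonneg {p : Fin 3 → ℝ} (hp : ∀ t, 0 < p t) (a : Fin 3) : 0 ≤ P3beta p a := by
  have h0 := hp 0
  have h1 := hp 1
  fin_cases a <;> simp [P3beta] <;> linarith

lemma P3beta_add_le_one {p : Fin 3 → ℝ} (hp : ∀ t, 0 < p t) (hsum : p 0 + p 1 + p 2 = 1)
    (a : Fin 3) : P3beta p a + p a ≤ 1 := by
  have h0 := hp 0
  have h1 := hp 1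
  have h2 := hp 2
  fin_cases a <;> simp [P3beta] <;> linarith

lemma mem_Ico_and_P3digit_eq_iff {p : Fin 3 → ℝ} (hp : ∀ t, 0 < p t)
    (hsum : p 0 + p 1 + p 2 = 1) (a : Fin 3) (x : ℝ) :
    x ∈ Set.Ico (0 : ℝ) 1 ∧ P3digit p x = a ↔
      (x - P3beta p a) / p a ∈ Set.Ico (0 : ℝ) 1 := by
  have h0 := hp 0
  have h1 := hp 1
  have h2 := hp 2
  rw [Set.mem_Ico, Set.mem_Ico, le_div_iff₀ (hp a), div_lt_one (hp a), P3digit]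
  fin_cases a <;> simp [P3beta] <;> split_ifs <;> simp <;> grind

lemma volume_P3digit_inter_P3map_preimage {p : Fin 3 → ℝ} (hp : ∀ t, 0 < p t)
    (hsum : p 0 + p 1 + p 2 = 1) (a : Fin 3) {E : Set ℝ} (hE : MeasurableSet E) :
    volume.restrict (Set.Ico (0 : ℝ) 1) (P3digit p ⁻¹' {a} ∩ P3map p ⁻¹' E) =
      ENNReal.ofReal (p a) * volume.restrict (Set.Ico (0 : ℝ) 1) E := by
  have hset : P3digit p ⁻¹' {a} ∩ P3map p ⁻¹' E ∩ Set.Ico (0 : ℝ) 1 =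
      (fun x => x + -P3beta p a) ⁻¹' ((fun y => y * (p a)⁻¹) ⁻¹' (E ∩ Set.Ico (0 : ℝ) 1)) := by
    ext x
    have h := mem_Ico_and_P3digit_eq_iff hp hsum a x
    simp only [Set.mem_inter_iff, Set.mem_preimage, Set.mem_singleton_iff, ← div_eq_mul_inv,
      ← sub_eq_add_neg]
    rw [← h]
    constructor
    · rintro ⟨⟨rfl, hx⟩, hI⟩
      exact ⟨hx, hI, rfl⟩
    · rintro ⟨hx, hI, rfl⟩
      exact ⟨⟨rfl, hx⟩, hI⟩
  rw [Measure.restrict_apply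
      ((measurable_P3digit p (measurableSet_singleton a)).inter (measurable_P3map p hE)),
    Measure.restrict_apply hE, hset, measure_preimage_add_right,
    Real.volume_preimage_mul_right (inv_ne_zero (hp a).ne'), inv_inv, abs_of_pos (hp a)]

lemma measurePreserving_P3map {p : Fin 3 → ℝ} (hp : ∀ t, 0 < p t)
    (hsum : p 0 + p 1 + p 2 = 1) :
    MeasurePreserving (P3map p) (volume.restrict (Set.Ico (0 : ℝ) 1))
      (volume.restrict (Set.Ico (0 : ℝ) 1)) := by
  refine ⟨measurable_P3map p, Measure.ext fun E hE => ?_⟩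
  rw [Measure.map_apply (measurable_P3map p) hE]
  have hcover : P3map p ⁻¹' E = ⋃ a, P3digit p ⁻¹' {a} ∩ P3map p ⁻¹' E := by
    ext x
    simp
  have hdisj : Pairwise (Function.onFun Disjoint
      fun a => P3digit p ⁻¹' {a} ∩ P3map p ⁻¹' E) := fun a b hab =>
    ((Set.disjoint_singleton.2 hab).preimage _).mono Set.inter_subset_left Set.inter_subset_left
  rw [hcover, measure_iUnion hdisj fun a =>
    (measurable_P3digit p (measurableSet_singleton a)).inter (measurable_P3map p hE)]
  simp_rw [volume_P3digit_inter_P3map_preimage hp hsum _ hE]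
  rw [ENNReal.tsum_mul_right, tsum_fintype, ← ENNReal.ofReal_sum_of_nonneg fun a _ => (hp a).le,
    Fin.sum_univ_three, hsum, ENNReal.ofReal_one, one_mul]

lemma volume_P3digit_preimage {p : Fin 3 → ℝ} (hp : ∀ t, 0 < p t)
    (hsum : p 0 + p 1 + p 2 = 1) (a : Fin 3) :
    volume.restrict (Set.Ico (0 : ℝ) 1) (P3digit p ⁻¹' {a}) = ENNReal.ofReal (p a) := by
  simpa using volume_P3digit_inter_P3map_preimage hp hsum a MeasurableSet.univ

lemma indepSet_P3digit_iterate {p : Fin 3 → ℝ} (hp : ∀ t, 0 < p t)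
    (hsum : p 0 + p 1 + p 2 = 1) (a : Fin 3) {j k : ℕ} (hjk : j < k) :
    ProbabilityTheory.IndepSet ((P3map p)^[j] ⁻¹' (P3digit p ⁻¹' {a}))
      ((P3map p)^[k] ⁻¹' (P3digit p ⁻¹' {a})) (volume.restrict (Set.Ico (0 : ℝ) 1)) := by
  have : IsProbabilityMeasure (volume.restrict (Set.Ico (0 : ℝ) 1)) := ⟨by simp⟩
  have hD := measurable_P3digit p (measurableSet_singleton a)
  have hT := measurePreserving_P3map hp hsum
  refine (ProbabilityTheory.indepSet_iff_measure_inter_eq_mul ((hT.iterate j).measurable hD)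
    ((hT.iterate k).measurable hD) _).2 ?_
  rw [(hT.iterate j).measure_preimage hD.nullMeasurableSet,
    (hT.iterate k).measure_preimage hD.nullMeasurableSet]
  obtain ⟨m, rfl⟩ := Nat.exists_eq_add_of_lt hjk
  have hE := (hT.iterate m).measurable hD
  have hsplit : (P3map p)^[j + m + 1] ⁻¹' (P3digit p ⁻¹' {a}) =
      (P3map p)^[j] ⁻¹' (P3map p ⁻¹' ((P3map p)^[m] ⁻¹' (P3digit p ⁻¹' {a}))) := by
    rw [show j + m + 1 = (m + 1) + j by ring, Function.iterate_add, Function.iterate_succ]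
    rfl
  rw [hsplit, ← Set.preimage_inter, (hT.iterate j).measure_preimage
    (hD.inter (hT.measurable hE)).nullMeasurableSet,
    volume_P3digit_inter_P3map_preimage hp hsum a hE,
    (hT.iterate m).measure_preimage hD.nullMeasurableSet, volume_P3digit_preimage hp hsum]

lemma ae_tendsto_P3digit_frequency {p : Fin 3 → ℝ} (hp : ∀ t, 0 < p t)
    (hsum : p 0 + p 1 + p 2 = 1) (s : Fin 3) :
    ∀ᵐ x ∂(volume.restrict (Set.Ico (0 : ℝ) 1)),
      Tendsto (fun k : ℕ => ((((Finset.range k).filter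
        fun r => P3digit p ((P3map p)^[r] x) = s).card : ℝ)) / k) atTop (nhds (p s)) := by
  have : IsProbabilityMeasure (volume.restrict (Set.Ico (0 : ℝ) 1)) := ⟨by simp⟩
  have hD := measurable_P3digit p (measurableSet_singleton s)
  have hT := measurePreserving_P3map hp hsum
  let X : ℕ → ℝ → ℝ := fun k =>
    ((P3map p)^[k] ⁻¹' (P3digit p ⁻¹' {s})).indicator fun _ => (1 : ℝ)
  have hX : ∀ k, Measurable (X k) := fun k =>
    measurable_const.indicator ((hT.iterate k).measurable hD)
  have hint : Integrable (X 0) (volume.restrict (Set.Ico (0 : ℝ) 1)) :=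
    (integrable_const (1 : ℝ)).indicator hD
  have hlt : ∀ j k, j < k → ProbabilityTheory.IndepFun (X j) (X k)
      (volume.restrict (Set.Ico (0 : ℝ) 1)) := fun j k hjk =>
    ProbabilityTheory.indep_of_indep_of_le (indepSet_P3digit_iterate hp hsum s hjk)
      (MeasurableSpace.comap_indicator_const_le_generateFrom_singleton _ _)
      (MeasurableSpace.comap_indicator_const_le_generateFrom_singleton _ _)
  have hind : Pairwise (Function.onFun (fun f g => ProbabilityTheory.IndepFun f g
      (volume.restrict (Set.Ico (0 : ℝ) 1))) X) := fun j k hjk =>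
    hjk.lt_or_gt.elim (hlt j k) fun h => (hlt k j h).symm
  have hident : ∀ k, ProbabilityTheory.IdentDistrib (X k) (X 0)
      (volume.restrict (Set.Ico (0 : ℝ) 1)) (volume.restrict (Set.Ico (0 : ℝ) 1)) := fun k => by
    refine ⟨(hX k).aemeasurable, (hX 0).aemeasurable, ?_⟩
    have hcomp : X k = X 0 ∘ (P3map p)^[k] := rfl
    rw [hcomp, ← Measure.map_map (hX 0) (hT.iterate k).measurable, (hT.iterate k).map_eq]
  have hmean : ∫ x, X 0 x ∂(volume.restrict (Set.Ico (0 : ℝ) 1)) = p s := by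
    change ∫ x, (P3digit p ⁻¹' {s}).indicator (fun _ => (1 : ℝ)) x
      ∂(volume.restrict (Set.Ico (0 : ℝ) 1)) = p s
    rw [integral_indicator_const _ hD, measureReal_def, volume_P3digit_preimage hp hsum,
      ENNReal.toReal_ofReal (hp s).le, smul_eq_mul, mul_one]
  filter_upwards [ProbabilityTheory.strong_law_ae_real X hint hind hident] with x hx
  rw [hmean] at hx
  refine hx.congr fun k => ?_
  rw [Finset.card_filter, Nat.cast_sum]
  congr 1
  refine Finset.sum_congr rfl fun r _ => ?_
  by_cases h : P3digit p ((P3map p)^[r] x) = s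
  · rw [if_pos h, Nat.cast_one]
    exact Set.indicator_of_mem (s := (P3map p)^[r] ⁻¹' (P3digit p ⁻¹' {s})) h
      fun _ => (1 : ℝ)
  · rw [if_neg h, Nat.cast_zero]
    exact Set.indicator_of_notMem (s := (P3map p)^[r] ⁻¹' (P3digit p ⁻¹' {s})) h
      fun _ => (1 : ℝ)

lemma sum_P3val_add_prod_le_one {p : Fin 3 → ℝ} (hp : ∀ t, 0 < p t)
    (hsum : p 0 + p 1 + p 2 = 1) (i : ℕ → Fin 3) (n : ℕ) :
    ∑ k ∈ Finset.range n, P3beta p (i k) * ∏ r ∈ Finset.range k, p (i r) +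
      ∏ r ∈ Finset.range n, p (i r) ≤ 1 := by
  induction n with
  | zero => simp
  | succ n ih =>
    rw [Finset.sum_range_succ, Finset.prod_range_succ]
    have hprod : 0 ≤ ∏ r ∈ Finset.range n, p (i r) := Finset.prod_nonneg fun r _ => (hp _).le
    nlinarith [mul_le_mul_of_nonneg_right (P3beta_add_le_one hp hsum (i n)) hprod]

lemma P3val_term_nonneg {p : Fin 3 → ℝ} (hp : ∀ t, 0 < p t) (i : ℕ → Fin 3) (k : ℕ) :
    0 ≤ P3beta p (i k) * ∏ r ∈ Finset.range k, p (i r) :=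
  mul_nonneg (P3beta_nonneg hp _) (Finset.prod_nonneg fun _ _ => (hp _).le)

lemma sum_P3val_le_one {p : Fin 3 → ℝ} (hp : ∀ t, 0 < p t)
    (hsum : p 0 + p 1 + p 2 = 1) (i : ℕ → Fin 3) (n : ℕ) :
    ∑ k ∈ Finset.range n, P3beta p (i k) * ∏ r ∈ Finset.range k, p (i r) ≤ 1 :=
  (le_add_of_nonneg_right (Finset.prod_nonneg fun _ _ => (hp _).le)).trans
    (sum_P3val_add_prod_le_one hp hsum i n)

lemma P3val_mem_Icc {p : Fin 3 → ℝ} (hp : ∀ t, 0 < p t)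
    (hsum : p 0 + p 1 + p 2 = 1) (i : ℕ → Fin 3) : P3val p i ∈ Set.Icc (0 : ℝ) 1 :=
  ⟨tsum_nonneg (P3val_term_nonneg hp i),
    Real.tsum_le_of_sum_range_le (P3val_term_nonneg hp i) (sum_P3val_le_one hp hsum i)⟩

lemma P3val_eq_add_mul_P3val_shift {p : Fin 3 → ℝ} (hp : ∀ t, 0 < p t)
    (hsum : p 0 + p 1 + p 2 = 1) (i : ℕ → Fin 3) :
    P3val p i = P3beta p (i 0) + p (i 0) * P3val p (P3shift i) := by
  have hs : Summable fun k => P3beta p (i k) * ∏ r ∈ Finset.range k, p (i r) :=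
    summable_of_sum_range_le (P3val_term_nonneg hp i) (sum_P3val_le_one hp hsum i)
  rw [P3val, hs.tsum_eq_zero_add, P3val, ← tsum_mul_left]
  congr 1
  · simp
  · refine tsum_congr fun k => ?_
    rw [Finset.prod_range_succ']
    simp only [P3shift]
    ring

/-- A point `β_a + p_a` of `[0, 1)` is the left end of the next branch of `P3map`. -/
lemma P3map_beta_add_eq_zero {p : Fin 3 → ℝ} (hp : ∀ t, 0 < p t)
    (hsum : p 0 + p 1 + p 2 = 1) (a : Fin 3) (h : P3beta p a + p a < 1) :
    P3map p (P3beta p a + p a) = 0 := by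
  have h1 := hp 1
  fin_cases a
  · simp [P3beta, P3map, P3digit, h1]
  · simp [P3beta, P3map, P3digit, h1.not_gt]
  · simp [P3beta, hsum] at h

lemma P3digit_iterate_P3val {p : Fin 3 → ℝ} (hp : ∀ t, 0 < p t)
    (hsum : p 0 + p 1 + p 2 = 1) (k : ℕ) :
    ∀ i : ℕ → Fin 3, P3val p i < 1 → (∀ j, (P3map p)^[j] (P3val p i) ≠ 0) →
      P3digit p ((P3map p)^[k] (P3val p i)) = i k := by
  have hstep : ∀ i : ℕ → Fin 3, P3val p i < 1 → P3map p (P3val p i) ≠ 0 →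
      P3digit p (P3val p i) = i 0 ∧ P3map p (P3val p i) = P3val p (P3shift i) ∧
        P3val p (P3shift i) < 1 := fun i hlt hne => by
    have hrec := P3val_eq_add_mul_P3val_shift hp hsum i
    have hmem := P3val_mem_Icc hp hsum (P3shift i)
    have hw : P3val p (P3shift i) < 1 := by
      refine lt_of_le_of_ne hmem.2 fun h1 => hne ?_
      rw [h1, mul_one] at hrec
      rw [hrec] at hlt ⊢
      exact P3map_beta_add_eq_zero hp hsum _ hlt
    have hdiv : (P3val p i - P3beta p (i 0)) / p (i 0) = P3val p (P3shift i) := by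
      rw [hrec, add_sub_cancel_left, mul_div_cancel_left₀ _ (hp _).ne']
    have hdig : P3digit p (P3val p i) = i 0 :=
      ((mem_Ico_and_P3digit_eq_iff hp hsum (i 0) _).2 (hdiv ▸ ⟨hmem.1, hw⟩)).2
    exact ⟨hdig, by rw [P3map, hdig, hdiv], hw⟩
  induction k with
  | zero => exact fun i hlt hne => (hstep i hlt (hne 1)).1
  | succ k ih =>
    intro i hlt hne
    obtain ⟨-, hmap, hw⟩ := hstep i hlt (hne 1)
    rw [Function.iterate_succ_apply, hmap]
    refine ih (P3shift i) hw fun j => ?_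
    rw [← hmap, ← Function.iterate_succ_apply]
    exact hne (j + 1)

theorem stmt16 (p : Fin 3 → ℝ) (hp : ∀ t, p t ∈ Set.Ioo (0 : ℝ) 1)
    (hsum : p 0 + p 1 + p 2 = 1) :
    ∀ᵐ x ∂(volume.restrict (Set.Icc (0 : ℝ) 1)),
      ∀ i : ℕ → Fin 3, P3val p i = x →
        ∀ s : Fin 3,
          Tendsto (fun k => ((((Finset.range k).filter fun r => i r = s).card : ℝ)) / k)
            atTop (nhds (p s)) := by
  have hpos : ∀ t, 0 < p t := fun t => (hp t).1
  have hT := measurePreserving_P3map hpos hsum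
  have hne : ∀ᵐ x ∂(volume.restrict (Set.Ico (0 : ℝ) 1)), ∀ j, (P3map p)^[j] x ≠ 0 :=
    ae_all_iff.2 fun j => (hT.iterate j).quasiMeasurePreserving.ae
      (Measure.ae_ne (volume.restrict (Set.Ico (0 : ℝ) 1)) 0)
  rw [← restrict_Ico_eq_restrict_Icc]
  filter_upwards [hne, ae_all_iff.2 (ae_tendsto_P3digit_frequency hpos hsum),
    ae_restrict_mem measurableSet_Ico] with x hx hfreq hmem i hi s
  subst hi
  simpa only [P3digit_iterate_P3val hpos hsum _ i hmem.2 hx] using hfreq s
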